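/- For every integer n ≥ 0, DSOME(625n + 26) ≡ 5·DSOME(n) − 2·d(n) (mod 8), where d(n) denotes the number of partitions of n into distinct parts (equivalently, d(n) is the coefficient of q^n in the formal power series f_2·f_1^{-1}). -/

import Mathlib

open PowerSeries

/-- `DSOME n`: the sum, over all partitions of `n` into distinct parts, of
(the sum of the odd parts) minus (the sum of the even parts). `DSOME 0 = 0`. -/
def DSOME (n : ℕ) : ℤ :=
  ∑ p ∈ Nat.Partition.distincts n,
    (((p.parts.filter (fun i => Odd i)).sum : ℤ) - ((p.parts.filter (fun i => Even i)).sum : ℤ))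

open Finset

/-- Integer solutions of `x ^ 2 + a * y ^ 2 = m` with `|x|, |y| ≤ m`. -/
noncomputable def reps (a m : ℤ) : Finset (ℤ × ℤ) :=
  {z ∈ Icc (-m) m ×ˢ Icc (-m) m | z.1 ^ 2 + a * z.2 ^ 2 = m}

theorem mem_reps {a m : ℤ} (ha : 1 ≤ a) {z : ℤ × ℤ} :
    z ∈ reps a m ↔ z.1 ^ 2 + a * z.2 ^ 2 = m := by
  simp only [reps, mem_filter, mem_product, mem_Icc, and_iff_right_iff_imp]
  intro h
  have hx : |z.1| ≤ z.1 ^ 2 := by simpa using Int.le_self_sq |z.1|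
  have hy : |z.2| ≤ z.2 ^ 2 := by simpa using Int.le_self_sq |z.2|
  have hx2 := sq_nonneg z.1
  have hy2 := sq_nonneg z.2
  refine ⟨abs_le.1 ?_, abs_le.1 ?_⟩ <;> nlinarith

/-- The quadratic character modulo `12` that is trivial at `± 1` and `-1` at `± 5`. -/
def chi (x : ℤ) : ℤ :=
  if x % 12 = 1 ∨ x % 12 = 11 then 1 else if x % 12 = 5 ∨ x % 12 = 7 then -1 else 0

theorem chi_neg (x : ℤ) : chi (-x) = chi x := by unfold chi; grind

theorem chi_five_mul (x : ℤ) : chi (5 * x) = -chi x := by unfold chi; grind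

theorem chi_sub_mul (x y : ℤ) : chi (x - 24 * y) = chi x := by unfold chi; grind

theorem chi_of_even {x : ℤ} (hx : Even x) : chi x = 0 := by
  unfold chi; grind

/-- The sign `(-1) ^ y`. -/
def altSign (y : ℤ) : ℤ := if Even y then 1 else -1

theorem altSign_neg (y : ℤ) : altSign (-y) = altSign y := by simp [altSign]

/-- If `-a` is a non-residue modulo `5`, then representations of `25 * m` are divisible by `5`. -/
theorem sum_reps_forty_eight (m : ℤ) (g : ℤ × ℤ → ℤ) (h5 : ∀ x y, g (5 * x, 5 * y) = -g (x, y)) :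
    ∑ z ∈ reps 48 (25 * m), g z = -∑ z ∈ reps 48 m, g z := by
  rw [← sum_neg_distrib]
  symm
  refine sum_nbij (fun z ↦ (5 * z.1, 5 * z.2)) ?_ ?_ ?_ ?_
  · intro z hz
    rw [mem_reps (by norm_num)] at hz ⊢
    simp only
    linarith
  · rintro ⟨a, b⟩ - ⟨c, d⟩ - h
    grind
  · rintro ⟨x, y⟩ hz
    rw [mem_coe, mem_reps (by norm_num)] at hz
    simp only at hz
    have h : x % 5 = 0 ∧ y % 5 = 0 := by
      have h5 : (x ^ 2 + 48 * y ^ 2) % 5 = 0 := by omega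
      have hx : x % 5 = 0 ∨ x % 5 = 1 ∨ x % 5 = 2 ∨ x % 5 = 3 ∨ x % 5 = 4 := by omega
      have hy : y % 5 = 0 ∨ y % 5 = 1 ∨ y % 5 = 2 ∨ y % 5 = 3 ∨ y % 5 = 4 := by omega
      rcases hx with hx | hx | hx | hx | hx <;> rcases hy with hy | hy | hy | hy | hy <;>
        simp [pow_two, Int.add_emod, Int.mul_emod, hx, hy] at h5 ⊢
    refine ⟨(x / 5, y / 5), ?_, ?_⟩
    · rw [mem_coe, mem_reps (by norm_num)]
      obtain ⟨u, rfl⟩ := Int.dvd_of_emod_eq_zero h.1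
      obtain ⟨v, rfl⟩ := Int.dvd_of_emod_eq_zero h.2
      simp only [Int.mul_ediv_cancel_left _ (by norm_num : (5 : ℤ) ≠ 0)]
      linarith
    · ext <;> simp only <;> omega
  · intro z _
    exact (h5 z.1 z.2).symm

theorem emod_five_of_sq_add (x y m : ℤ) (h : x ^ 2 + 24 * y ^ 2 = 25 * m) :
    (x - y) % 5 = 0 ∨ (x + y) % 5 = 0 := by
  have h5 : (x - y) * (x + y) = 5 * (5 * m - 5 * y ^ 2) := by linear_combination h
  have h6 : (5 : ℤ) ∣ (x - y) * (x + y) := ⟨_, h5⟩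
  rcases (Int.prime_iff_natAbs_prime.2 (by norm_num)).dvd_or_dvd h6 with h | h
  · exact Or.inl (Int.emod_eq_zero_of_dvd h)
  · exact Or.inr (Int.emod_eq_zero_of_dvd h)

/-- Multiplication by `1 + √-24`. -/
theorem sum_reps_rotate (m : ℤ) (g : ℤ × ℤ → ℤ) :
    ∑ z ∈ reps 24 (25 * m) with ¬ 5 ∣ z.1 + z.2, g z =
      ∑ z ∈ reps 24 m with ¬ 5 ∣ z.1 + z.2, g (z.1 - 24 * z.2, z.1 + z.2) := by
  symm
  refine sum_nbij (fun z ↦ (z.1 - 24 * z.2, z.1 + z.2)) ?_ ?_ ?_ ?_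
  · rintro ⟨x, y⟩ hz
    rw [mem_filter, mem_reps (by norm_num)] at hz ⊢
    simp only at hz ⊢
    exact ⟨by linear_combination 25 * hz.1, by omega⟩
  · rintro ⟨a, b⟩ - ⟨c, d⟩ - h
    grind
  · rintro ⟨x, y⟩ hz
    rw [mem_coe, mem_filter, mem_reps (by norm_num)] at hz
    simp only at hz
    obtain ⟨hz, h5⟩ := hz
    have hxy : (x - y) % 5 = 0 := by
      rcases emod_five_of_sq_add x y m hz with h | h <;> omega
    have h25 : (25 : ℤ) ∣ x - y := by
      have h : (5 : ℤ) ^ 2 ∣ (x - y) * (x + y) := ⟨m - y ^ 2, by linear_combination hz⟩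
      have hc : IsCoprime ((5 : ℤ) ^ 2) (x + y) :=
        ((Int.prime_iff_natAbs_prime.2 (by norm_num)).coprime_iff_not_dvd.2 h5).pow_left
      exact hc.dvd_of_dvd_mul_right h
    obtain ⟨k, hk⟩ := h25
    obtain rfl : x = y + 25 * k := by linarith
    refine ⟨(y + k, -k), ?_, ?_⟩
    · rw [mem_coe, mem_filter, mem_reps (by norm_num)]
      simp only
      exact ⟨by linarith, by omega⟩
    · ext <;> simp only <;> ring
  · intro z _
    rfl

theorem sum_reps_conj (m : ℤ) (g : ℤ × ℤ → ℤ) (hc : ∀ x y, g (x, -y) = g (x, y)) :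
    ∑ z ∈ reps 24 (25 * m) with 5 ∣ z.1 + z.2 ∧ ¬ 5 ∣ z.1, g z =
      ∑ z ∈ reps 24 (25 * m) with ¬ 5 ∣ z.1 + z.2, g z := by
  refine sum_nbij' (fun z ↦ (z.1, -z.2)) (fun z ↦ (z.1, -z.2)) ?_ ?_ ?_ ?_ ?_
  · rintro ⟨x, y⟩ hz
    rw [mem_filter, mem_reps (by norm_num)] at hz ⊢
    simp only at hz ⊢
    exact ⟨by linear_combination hz.1, by omega⟩
  · rintro ⟨x, y⟩ hz
    rw [mem_filter, mem_reps (by norm_num)] at hz ⊢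
    simp only at hz ⊢
    refine ⟨by linear_combination hz.1, ?_⟩
    rcases emod_five_of_sq_add x y m hz.1 with h | h <;> omega
  · simp
  · simp
  · intro z _
    exact (hc _ _).symm

theorem sum_reps_five_dvd (m : ℤ) (g : ℤ × ℤ → ℤ) :
    ∑ z ∈ reps 24 (25 * m) with 5 ∣ z.1 + z.2 ∧ 5 ∣ z.1, g z =
      ∑ z ∈ reps 24 m, g (5 * z.1, 5 * z.2) := by
  symm
  refine sum_nbij (fun z ↦ (5 * z.1, 5 * z.2)) ?_ ?_ ?_ ?_
  · rintro ⟨x, y⟩ hz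
    rw [mem_reps (by norm_num)] at hz
    rw [mem_filter, mem_reps (by norm_num)]
    simp only at hz ⊢
    exact ⟨by linear_combination 25 * hz, by omega, by omega⟩
  · rintro ⟨a, b⟩ - ⟨c, d⟩ - h
    grind
  · rintro ⟨x, y⟩ hz
    rw [mem_coe, mem_filter, mem_reps (by norm_num)] at hz
    simp only at hz
    obtain ⟨u, rfl⟩ := hz.2.2
    obtain ⟨v, rfl⟩ : 5 ∣ y := by omega
    refine ⟨(u, v), ?_, rfl⟩
    rw [mem_coe, mem_reps (by norm_num)]
    simp only
    linarith
  · intro z _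
    rfl

/-- The action of the prime `5` on theta series of `x ^ 2 + 24 * y ^ 2`. -/
theorem sum_reps_mul_625 (m δ : ℤ) (hδ : δ ^ 2 = 1) (g : ℤ × ℤ → ℤ)
    (hc : ∀ x y, g (x, -y) = g (x, y)) (h5 : ∀ x y, g (5 * x, 5 * y) = -g (x, y))
    (hω : ∀ x y, g (x - 24 * y, x + y) = δ * g (x, y)) :
    ∑ z ∈ reps 24 (625 * m), g z = ∑ z ∈ reps 24 m, g z +
      2 * (1 - δ) * ∑ z ∈ reps 24 m with ¬ 5 ∣ z.1 + z.2, g z := by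
  have key (m : ℤ) : ∑ z ∈ reps 24 (25 * m), g z = -∑ z ∈ reps 24 m, g z +
      2 * ∑ z ∈ reps 24 (25 * m) with ¬ 5 ∣ z.1 + z.2, g z := by
    rw [← sum_filter_add_sum_filter_not _ (fun z ↦ 5 ∣ z.1 + z.2),
      ← sum_filter_add_sum_filter_not (filter _ _) (fun z ↦ 5 ∣ z.1), filter_filter, filter_filter,
      sum_reps_conj m g hc, sum_reps_five_dvd]
    simp only [h5, sum_neg_distrib]
    ring
  have rot (m : ℤ) : ∑ z ∈ reps 24 (25 * m) with ¬ 5 ∣ z.1 + z.2, g z =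
      δ * ∑ z ∈ reps 24 m with ¬ 5 ∣ z.1 + z.2, g z := by
    simp only [sum_reps_rotate, hω, mul_sum]
  rw [show 625 * m = 25 * (25 * m) by ring]
  linear_combination key (25 * m) - key m + 2 * rot (25 * m) + (2 * δ - 2) * rot m +
    (2 * ∑ z ∈ reps 24 m with ¬ 5 ∣ z.1 + z.2, g z) * hδ

/-- The prime ideal above `5` is acted on freely by `z ↦ -z` and by `z ↦ conj (ω z) / 5`, where
`ω = 1 + √-24`. -/
theorem four_dvd_sum_reps_ideal (m : ℤ) (hm : Odd m) (g : ℤ × ℤ → ℤ)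
    (hc : ∀ x y, g (x, -y) = g (x, y)) (hn : ∀ x y, g (-x, y) = g (x, y))
    (h5 : ∀ x y, g (5 * x, 5 * y) = -g (x, y))
    (hω : ∀ x y, g (x - 24 * y, x + y) = -g (x, y)) :
    4 ∣ ∑ z ∈ reps 24 m with 5 ∣ z.1 + z.2, g z := by
  have hodd {x y : ℤ} (h : x ^ 2 + 24 * y ^ 2 = m) : Odd x := by
    rw [← h] at hm
    simpa [Int.odd_add, Int.odd_pow, Int.even_mul, show Even (24 : ℤ) by decide] using hm
  have h1 : ∑ z ∈ reps 24 m with 5 ∣ z.1 + z.2 ∧ ¬ (5 * z.1) ^ 2 < (z.1 - 24 * z.2) ^ 2, g z =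
      ∑ z ∈ reps 24 m with 5 ∣ z.1 + z.2 ∧ (5 * z.1) ^ 2 < (z.1 - 24 * z.2) ^ 2, g z := by
    refine sum_nbij' (fun z ↦ ((z.1 - 24 * z.2) / 5, -((z.1 + z.2) / 5)))
      (fun z ↦ ((z.1 - 24 * z.2) / 5, -((z.1 + z.2) / 5))) ?_ ?_ ?_ ?_ ?_
    · rintro ⟨x, y⟩ hz
      rw [mem_filter, mem_reps (by norm_num)] at hz ⊢
      simp only at hz ⊢
      obtain ⟨hz, ⟨k, hk⟩, hlt⟩ := hz
      have hx := hodd hz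
      obtain rfl : x = 5 * k - y := by linarith
      rw [show (5 * k - y - 24 * y) / 5 = k - 5 * y by omega,
        show (5 * k - y + y) / 5 = k by omega]
      refine ⟨by linarith, by omega, ?_⟩
      have hne : (5 * (5 * k - y)) ^ 2 ≠ (5 * k - y - 24 * y) ^ 2 := by
        intro h
        rcases sq_eq_sq_iff_eq_or_eq_neg.1 h with h | h
        · grind
        · grind
      have : (5 * k - y - 24 * y) ^ 2 < (5 * (5 * k - y)) ^ 2 := by
        rcases lt_or_gt_of_ne hne with h | h
        · exact absurd h hlt
        · exact h
      nlinarith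
    · rintro ⟨x, y⟩ hz
      rw [mem_filter, mem_reps (by norm_num)] at hz ⊢
      simp only at hz ⊢
      obtain ⟨hz, ⟨k, hk⟩, hlt⟩ := hz
      obtain rfl : x = 5 * k - y := by linarith
      rw [show (5 * k - y - 24 * y) / 5 = k - 5 * y by omega,
        show (5 * k - y + y) / 5 = k by omega]
      refine ⟨by linarith, by omega, ?_⟩
      nlinarith
    · rintro ⟨x, y⟩ hz
      rw [mem_filter] at hz
      ext <;> simp only at hz ⊢ <;> omega
    · rintro ⟨x, y⟩ hz
      rw [mem_filter] at hz
      ext <;> simp only at hz ⊢ <;> omega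
    · rintro ⟨x, y⟩ hz
      rw [mem_filter] at hz
      obtain ⟨-, ⟨k, hk⟩, -⟩ := hz
      simp only at hk ⊢
      have h := h5 ((x - 24 * y) / 5) (-((x + y) / 5))
      rw [show 5 * ((x - 24 * y) / 5) = x - 24 * y by omega,
        show 5 * -((x + y) / 5) = -(x + y) by omega, hc, hω] at h
      linarith
  have h2 : ∑ z ∈ reps 24 m with
        (5 ∣ z.1 + z.2 ∧ (5 * z.1) ^ 2 < (z.1 - 24 * z.2) ^ 2) ∧ ¬ 0 < z.1, g z =
      ∑ z ∈ reps 24 m with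
        (5 ∣ z.1 + z.2 ∧ (5 * z.1) ^ 2 < (z.1 - 24 * z.2) ^ 2) ∧ 0 < z.1, g z := by
    refine sum_nbij' (fun z ↦ (-z.1, -z.2)) (fun z ↦ (-z.1, -z.2)) ?_ ?_ ?_ ?_ ?_
    · rintro ⟨x, y⟩ hz
      rw [mem_filter, mem_reps (by norm_num)] at hz ⊢
      simp only at hz ⊢
      have hx := hodd hz.1
      refine ⟨by linarith, ⟨by omega, by nlinarith⟩, ?_⟩
      grind
    · rintro ⟨x, y⟩ hz
      rw [mem_filter, mem_reps (by norm_num)] at hz ⊢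
      simp only at hz ⊢
      exact ⟨by linarith, ⟨by omega, by nlinarith⟩, by omega⟩
    · simp
    · simp
    · rintro ⟨x, y⟩ _
      rw [hn, hc]
  rw [← sum_filter_add_sum_filter_not (filter _ _)
    (fun z ↦ (5 * z.1) ^ 2 < (z.1 - 24 * z.2) ^ 2), filter_filter, filter_filter, h1,
    ← sum_filter_add_sum_filter_not (filter _ _) (fun z ↦ 0 < z.1), filter_filter, filter_filter,
    h2]
  exact ⟨_, by ring⟩

/-- Finite sets of positive integers with sum `n`. -/
def distinctSets (n : ℕ) : Finset (Finset ℕ) := {s ∈ (Icc 1 n).powerset | ∑ i ∈ s, i = n}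

theorem mem_distinctSets {n : ℕ} {s : Finset ℕ} :
    s ∈ distinctSets n ↔ (∀ i ∈ s, 0 < i) ∧ ∑ i ∈ s, i = n := by
  simp only [distinctSets, mem_filter, mem_powerset, and_congr_left_iff]
  rintro rfl
  refine ⟨fun h i hi ↦ (mem_Icc.1 (h hi)).1, fun h i hi ↦ mem_Icc.2 ⟨h i hi, ?_⟩⟩
  exact single_le_sum (f := fun i ↦ i) (fun _ _ ↦ Nat.zero_le _) hi

theorem sum_distincts {M : Type*} [AddCommMonoid M] (n : ℕ) (f : Multiset ℕ → M) :
    ∑ p ∈ Nat.Partition.distincts n, f p.parts = ∑ s ∈ distinctSets n, f s.val := by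
  refine sum_nbij (fun p ↦ p.parts.toFinset) ?_ ?_ ?_ ?_
  · intro p hp
    have hp : p.parts.Nodup := by simpa [Nat.Partition.distincts] using hp
    rw [mem_distinctSets]
    refine ⟨fun i hi ↦ p.parts_pos (Multiset.mem_toFinset.1 hi), ?_⟩
    have h : ∑ i ∈ p.parts.toFinset, i = p.parts.sum := by
      have := sum_val p.parts.toFinset
      rw [Multiset.toFinset_val, hp.dedup] at this
      exact this.symm
    exact h.trans p.parts_sum
  · intro p hp q hq h
    have hp : p.parts.Nodup := by simpa [Nat.Partition.distincts] using hp
    have hq : q.parts.Nodup := by simpa [Nat.Partition.distincts] using hq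
    ext1
    have := congrArg Finset.val h
    simpa [hp.dedup, hq.dedup] using this
  · intro s hs
    rw [mem_coe, mem_distinctSets] at hs
    refine ⟨⟨s.val, fun {i} hi ↦ hs.1 i hi, ?_⟩, ?_, ?_⟩
    · rw [sum_val]; exact hs.2
    · simpa [Nat.Partition.distincts] using s.nodup
    · simp
  · intro p hp
    have hp : p.parts.Nodup := by simpa [Nat.Partition.distincts] using hp
    simp [hp.dedup]

/-- The number of partitions of `n` into distinct parts one of which is `k`. -/
def countContaining (k n : ℕ) : ℕ := #{s ∈ distinctSets n | k ∈ s}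

theorem countContaining_of_lt {k n : ℕ} (h : n < k) : countContaining k n = 0 := by
  rw [countContaining, card_eq_zero, filter_eq_empty_iff]
  intro s hs hk
  rw [distinctSets, mem_filter, mem_powerset] at hs
  have := mem_Icc.1 (hs.1 hk)
  omega

theorem countContaining_add {k n : ℕ} (hk : 0 < k) :
    countContaining k (n + k) + countContaining k n = #(distinctSets n) := by
  rw [← card_filter_add_card_filter_not (s := distinctSets n) (fun s ↦ k ∈ s), add_comm]
  congr 1
  refine card_nbij' (fun s ↦ s.erase k) (fun s ↦ insert k s) ?_ ?_ ?_ ?_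
  · intro s hs
    simp only [mem_coe, mem_filter, mem_distinctSets] at hs ⊢
    refine ⟨⟨fun i hi ↦ hs.1.1 i (mem_of_mem_erase hi), ?_⟩, notMem_erase _ _⟩
    have := add_sum_erase s (fun i ↦ i) hs.2
    omega
  · intro s hs
    simp only [mem_coe, mem_filter, mem_distinctSets] at hs ⊢
    refine ⟨⟨fun i hi ↦ ?_, ?_⟩, mem_insert_self _ _⟩
    · rcases mem_insert.1 hi with rfl | hi
      · exact hk
      · exact hs.1.1 i hi
    · rw [sum_insert hs.2, hs.1.2, add_comm]
  · intro s hs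
    simp only [mem_coe, mem_filter] at hs
    exact insert_erase hs.2
  · intro s hs
    simp only [mem_coe, mem_filter] at hs
    exact erase_insert hs.2

theorem countContaining_modTwo {k : ℕ} (hk : 0 < k) (n : ℕ) :
    (countContaining k n : ZMod 2) = ∑ t ∈ range n with k ∣ n - t, (#(distinctSets t) : ZMod 2) := by
  induction n using Nat.strong_induction_on with
  | _ n ih =>
    rcases lt_or_ge n k with h | h
    · rw [countContaining_of_lt h, filter_false_of_mem, sum_empty, Nat.cast_zero]
      intro t ht hd
      rw [mem_range] at ht
      have := Nat.le_of_dvd (by omega) hd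
      omega
    · obtain ⟨l, rfl⟩ := Nat.exists_eq_add_of_le' h
      have hl : ({t ∈ range (l + k) | k ∣ l + k - t} : Finset ℕ) =
          insert l {t ∈ range l | k ∣ l - t} := by
        ext t
        simp only [mem_filter, mem_range, mem_insert]
        constructor
        · rintro ⟨h1, h2⟩
          have := Nat.le_of_dvd (by omega) h2
          rcases (show t = l ∨ t < l by omega) with h3 | h3
          · exact Or.inl h3
          · refine Or.inr ⟨h3, ?_⟩
            rwa [show l + k - t = l - t + k by omega, Nat.dvd_add_self_right] at h2
        · rintro (rfl | ⟨h1, h2⟩)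
          · simp [hk]
          · refine ⟨by omega, ?_⟩
            rwa [show l + k - t = l - t + k by omega, Nat.dvd_add_self_right]
      rw [hl, sum_insert (by simp), ← ih l (by omega), ← countContaining_add hk (n := l)]
      push_cast
      rw [add_assoc, CharTwo.add_self_eq_zero, add_zero]

theorem card_distincts (n : ℕ) : #(Nat.Partition.distincts n) = #(distinctSets n) := by
  rw [card_eq_sum_ones, card_eq_sum_ones]
  exact sum_distincts n (fun _ ↦ 1)

theorem DSOME_eq (n : ℕ) :
    DSOME n = n * #(distinctSets n) - 4 * ∑ j ∈ Icc 1 n, j * countContaining (2 * j) n := by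
  have h1 (s : Finset ℕ) (hs : s ∈ distinctSets n) :
      (((s.val.filter (fun i ↦ Odd i)).sum : ℤ) - ((s.val.filter (fun i ↦ Even i)).sum : ℤ)) =
        n - 4 * ∑ j ∈ Icc 1 n, if 2 * j ∈ s then (j : ℤ) else 0 := by
    have h2 : ∑ i ∈ s with Even i, i = ∑ j ∈ Icc 1 n with 2 * j ∈ s, 2 * j := by
      symm
      refine sum_nbij (fun j ↦ 2 * j) ?_ ?_ ?_ ?_
      · intro j hj
        simp only [mem_filter] at hj ⊢
        exact ⟨hj.2, even_two_mul j⟩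
      · intro a _ b _ h
        simpa using h
      · intro i hi
        simp only [mem_coe, mem_filter, distinctSets, mem_powerset] at hi hs
        obtain ⟨j, rfl⟩ := hi.2.two_dvd
        have := mem_Icc.1 (hs.1 hi.1)
        refine ⟨j, ?_, rfl⟩
        simp only [mem_coe, mem_filter, mem_Icc]
        exact ⟨by omega, hi.1⟩
      · intro j _
        rfl
    have h3 : ∑ i ∈ s with Odd i, i + ∑ i ∈ s with Even i, i = n := by
      rw [← (mem_distinctSets.1 hs).2, add_comm,
        ← sum_filter_add_sum_filter_not s (fun i ↦ Even i)]
      simp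
    rw [← filter_val, ← filter_val, sum_val, sum_val]
    simp only [id]
    rw [h2] at h3 ⊢
    rw [← sum_filter]
    have h4 : ((∑ i ∈ s with Odd i, i + ∑ j ∈ Icc 1 n with 2 * j ∈ s, 2 * j : ℕ) : ℤ) = n := by
      rw [h3]
    rw [← mul_sum] at h4 ⊢
    push_cast at h4 ⊢
    linarith
  rw [DSOME, sum_distincts (M := ℤ) n (fun P ↦ ((P.filter (fun i ↦ Odd i)).sum : ℤ) -
    ((P.filter (fun i ↦ Even i)).sum : ℤ)), sum_congr rfl h1, sum_sub_distrib, ← mul_sum, sum_comm,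
    sum_const, nsmul_eq_mul, mul_comm]
  push_cast
  congr 2
  refine sum_congr rfl fun j _ ↦ ?_
  rw [← sum_filter, sum_const, nsmul_eq_mul, mul_comm, countContaining]

/-- Gaussian binomial coefficients at an element `q` of a commutative ring. -/
def qChoose {R : Type*} [CommRing R] (q : R) : ℕ → ℕ → R
  | _, 0 => 1
  | 0, _ + 1 => 0
  | N + 1, k + 1 => qChoose q N k + q ^ (k + 1) * qChoose q N (k + 1)

section qChoose

variable {R S : Type*} [CommRing R] [CommRing S] (q : R)

@[simp]
theorem qChoose_zero_right (N : ℕ) : qChoose q N 0 = 1 := by cases N <;> rfl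

theorem qChoose_succ_succ (N k : ℕ) :
    qChoose q (N + 1) (k + 1) = qChoose q N k + q ^ (k + 1) * qChoose q N (k + 1) := rfl

theorem qChoose_eq_zero {N k : ℕ} (h : N < k) : qChoose q N k = 0 := by
  induction N generalizing k with
  | zero => obtain ⟨k, rfl⟩ := Nat.exists_eq_succ_of_ne_zero h.ne_bot; rfl
  | succ N ih =>
    obtain ⟨k, rfl⟩ := Nat.exists_eq_succ_of_ne_zero (Nat.ne_zero_of_lt h)
    rw [Nat.succ_eq_add_one, qChoose_succ_succ, ih (by omega), ih (by omega), mul_zero, add_zero]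

theorem map_qChoose (φ : R →+* S) (N k : ℕ) : φ (qChoose q N k) = qChoose (φ q) N k := by
  induction N generalizing k with
  | zero => cases k <;> simp [qChoose]
  | succ N ih => cases k <;> simp [qChoose_succ_succ, ih]

/-- The finite Euler product `∏_{i ≤ n} (1 - q ^ i)`. -/
def qFactorial (n : ℕ) : R := ∏ i ∈ range n, (1 - q ^ (i + 1))

theorem qChoose_mul_qFactorial (n k : ℕ) :
    qChoose q (n + k) k * (qFactorial q n * qFactorial q k) = qFactorial q (n + k) := by
  induction k generalizing n with
  | zero => simp [qFactorial]
  | succ k ih =>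
    induction n with
    | zero =>
      have h := ih 0
      simp only [zero_add] at h ⊢
      rw [qChoose_succ_succ, qChoose_eq_zero q (Nat.lt_succ_self k)]
      simp only [qFactorial, prod_range_succ, range_zero, prod_empty] at h ⊢
      linear_combination (1 - q ^ (k + 1)) * h
    | succ n ih2 =>
      have h := ih (n + 1)
      rw [show n + 1 + (k + 1) = (n + (k + 1)) + 1 by ring, qChoose_succ_succ]
      rw [show n + 1 + k = n + (k + 1) by ring] at h
      simp only [qFactorial, prod_range_succ] at h ih2 ⊢
      rw [show n + (k + 1) = n + k + 1 by ring] at *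
      simp only [prod_range_succ] at h ih2 ⊢
      linear_combination (1 - q ^ (k + 1)) * h + q ^ (k + 1) * (1 - q ^ (n + 1)) * ih2

theorem prod_add_mul_pow (x y : R) (N : ℕ) :
    ∏ j ∈ range N, (y + x * q ^ j) =
      ∑ k ∈ range (N + 1), q ^ k.choose 2 * qChoose q N k * x ^ k * y ^ (N - k) := by
  induction N generalizing x with
  | zero => simp
  | succ N ih =>
    have h1 : ∏ j ∈ range N, (y + x * q ^ (j + 1)) =
        ∑ k ∈ range (N + 1), q ^ k.choose 2 * qChoose q N k * (x * q) ^ k * y ^ (N - k) := by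
      rw [← ih]
      exact prod_congr rfl fun j _ ↦ by ring
    rw [prod_range_succ', h1, sum_range_succ' _ (N + 1)]
    have h2 (k : ℕ) (hk : k ∈ range (N + 1)) :
        q ^ (k + 1).choose 2 * qChoose q (N + 1) (k + 1) * x ^ (k + 1) * y ^ (N + 1 - (k + 1)) =
        x * (q ^ k.choose 2 * qChoose q N k * (x * q) ^ k * y ^ (N - k)) +
        q ^ (k + 1).choose 2 * qChoose q N (k + 1) * (x * q) ^ (k + 1) * y ^ (N - k) := by
      rw [qChoose_succ_succ, Nat.add_sub_add_right, Nat.choose_succ_succ' k 1, Nat.choose_one_right]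
      ring
    rw [sum_congr rfl h2, sum_add_distrib, ← mul_sum]
    have h3 : ∑ k ∈ range (N + 1),
        q ^ (k + 1).choose 2 * qChoose q N (k + 1) * (x * q) ^ (k + 1) * y ^ (N - k) + y ^ (N + 1) =
        y * ∑ k ∈ range (N + 1), q ^ k.choose 2 * qChoose q N k * (x * q) ^ k * y ^ (N - k) := by
      rw [sum_range_succ, qChoose_eq_zero q (Nat.lt_succ_self N), sum_range_succ', mul_add, mul_sum]
      congr 1
      · simp only [mul_zero, zero_mul, add_zero]
        refine sum_congr rfl fun k hk ↦ ?_
        rw [mem_range] at hk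
        rw [show N - k = N - (k + 1) + 1 by omega]
        ring
      · simp [pow_succ']
    simp only [Nat.choose_zero_succ, pow_zero, qChoose_zero_right, mul_one, one_mul, Nat.sub_zero]
    rw [add_assoc, h3]
    ring

end qChoose

/-- A finite form of the Jacobi triple product at `-1`. -/
theorem sum_neg_one_pow_mul_qChoose (n : ℕ) :
    ∑ m ∈ range (2 * n + 1),
      (-1) ^ m * (X : ℤ⟦X⟧) ^ (((m : ℤ) - n).natAbs ^ 2) * qChoose (X ^ 2) (2 * n) m =
      (-1) ^ n * (∏ i ∈ range n, (1 - (X : ℤ⟦X⟧) ^ (2 * i + 1))) ^ 2 := by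
  rcases n.eq_zero_or_pos with rfl | hn
  · simp
  have h := prod_add_mul_pow ((X : ℤ⟦X⟧) ^ 2) (-1) (X ^ (2 * n - 1)) (2 * n)
  have hX : (X : ℤ⟦X⟧) ^ (n * (n - 1) + (2 * n - 1) * n) ≠ 0 := pow_ne_zero _ X_ne_zero
  have h1 : ∏ j ∈ range n, ((X : ℤ⟦X⟧) ^ (2 * n - 1) + -1 * (X ^ 2) ^ j) =
      (-1) ^ n * X ^ (n * (n - 1)) * ∏ i ∈ range n, (1 - (X : ℤ⟦X⟧) ^ (2 * i + 1)) := by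
    rw [← prod_range_reflect (fun i ↦ 1 - (X : ℤ⟦X⟧) ^ (2 * i + 1)), ← sum_range_id_mul_two,
      mul_comm _ 2, pow_mul, ← prod_pow_eq_pow_sum]
    rw [show (-1 : ℤ⟦X⟧) ^ n = ∏ j ∈ range n, (-1) by simp, ← prod_mul_distrib, ← prod_mul_distrib]
    refine prod_congr rfl fun j hj ↦ ?_
    rw [mem_range] at hj
    rw [show 2 * n - 1 = 2 * j + (2 * (n - 1 - j) + 1) by omega]
    ring
  have h2 : ∏ j ∈ range n, ((X : ℤ⟦X⟧) ^ (2 * n - 1) + -1 * (X ^ 2) ^ (n + j)) =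
      X ^ ((2 * n - 1) * n) * ∏ i ∈ range n, (1 - (X : ℤ⟦X⟧) ^ (2 * i + 1)) := by
    rw [pow_mul, show ((X : ℤ⟦X⟧) ^ (2 * n - 1)) ^ n = ∏ j ∈ range n, (X : ℤ⟦X⟧) ^ (2 * n - 1) by
      simp, ← prod_mul_distrib]
    refine prod_congr rfl fun j hj ↦ ?_
    obtain ⟨l, rfl⟩ := Nat.exists_eq_add_of_le' hn
    rw [show 2 * (l + 1) - 1 = 2 * l + 1 by omega]
    ring
  rw [two_mul n, prod_range_add, ← two_mul, h1, h2] at h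
  apply mul_left_cancel₀ hX
  rw [mul_sum]
  refine Eq.trans (sum_congr rfl fun m hm ↦ ?_) (h.symm.trans ?_)
  · rw [mem_range] at hm
    have hexp : n * (n - 1) + (2 * n - 1) * n + ((m : ℤ) - n).natAbs ^ 2 =
        2 * m.choose 2 + (2 * n - 1) * (2 * n - m) := by
      have h3 : 2 * m.choose 2 = m * (m - 1) := by
        rw [mul_comm, Nat.choose_two_right, Nat.div_mul_cancel (Nat.even_mul_pred_self m).two_dvd]
      rw [h3]
      zify [hn, show m ≤ 2 * n by omega, show 1 ≤ 2 * n by omega]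
      rw [sq_abs]
      rcases m.eq_zero_or_pos with rfl | hm
      · push_cast; ring
      · zify [hm]; ring
    calc _ = (X : ℤ⟦X⟧) ^ (n * (n - 1) + (2 * n - 1) * n + ((m : ℤ) - n).natAbs ^ 2) * (-1) ^ m *
          qChoose (X ^ 2) (2 * n) m := by ring
      _ = _ := by rw [hexp]; ring
  · ring

/-- The theta series `∑ g y * X ^ (a * y ^ 2)` over the integers. -/
noncomputable def theta (a : ℕ) (g : ℤ → ℤ) : ℤ⟦X⟧ :=
  PowerSeries.mk fun j ↦ ∑ y ∈ Icc (-(j : ℤ)) (j : ℤ) with (a : ℤ) * y ^ 2 = (j : ℤ), g y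

/-- The generating function of partitions into distinct parts. -/
noncomputable def distinctSeries : ℤ⟦X⟧ := PowerSeries.mk fun n ↦ (#(distinctSets n) : ℤ)

theorem coeff_prod_one_add_X_pow {i n : ℕ} (h : i ≤ n) :
    coeff i (∏ j ∈ range n, (1 + (X : ℤ⟦X⟧) ^ (j + 1))) = (#(distinctSets i) : ℤ) := by
  rw [range_eq_Ico, prod_Ico_add' (fun j : ℕ ↦ (1 : ℤ⟦X⟧) + X ^ j) 0 n 1, prod_one_add, map_sum]
  have h1 (s : Finset ℕ) : coeff i (∏ j ∈ s, (X : ℤ⟦X⟧) ^ j) = if i = ∑ j ∈ s, j then 1 else 0 := by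
    rw [prod_pow_eq_pow_sum s (fun j ↦ j), coeff_X_pow]
  simp only [h1]
  rw [sum_boole]
  congr 2
  ext s
  simp only [mem_filter, mem_powerset, mem_distinctSets]
  refine ⟨fun h2 ↦ ⟨fun k hk ↦ ?_, h2.2.symm⟩, fun h2 ↦ ⟨fun k hk ↦ ?_, h2.2.symm⟩⟩
  · have := mem_Ico.1 (h2.1 hk)
    omega
  · have := single_le_sum (f := fun k ↦ k) (fun _ _ ↦ Nat.zero_le _) hk
    have := h2.1 k hk
    simp only [mem_Ico]
    omega

theorem neg_one_pow_eq_altSign {m n : ℕ} : (-1 : ℤ) ^ m = (-1) ^ n * altSign (m - n) := by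
  unfold altSign
  simp only [Int.even_sub]
  rcases m.even_or_odd with hm | hm <;> rcases n.even_or_odd with hn | hn <;>
    simp [hm, hn, hm.neg_one_pow, hn.neg_one_pow]
  grind

theorem coeff_sum_neg_one_pow {c n : ℕ} (h : c ≤ n) :
    coeff c (∑ m ∈ range (2 * n + 1), (-1) ^ m * (X : ℤ⟦X⟧) ^ (((m : ℤ) - n).natAbs ^ 2)) =
      coeff c ((-1) ^ n * theta 1 altSign) := by
  have h1 (m : ℕ) : (-1 : ℤ⟦X⟧) ^ m = C ((-1) ^ m) := by simp
  rw [map_sum, h1, coeff_C_mul, theta, coeff_mk, mul_sum]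
  simp only [h1, coeff_C_mul, coeff_X_pow, mul_ite, mul_one, mul_zero]
  rw [← sum_filter]
  refine sum_nbij (fun m ↦ (m : ℤ) - n) ?_ ?_ ?_ ?_
  · intro m hm
    simp only [mem_filter, mem_Icc] at hm ⊢
    have h2 : (c : ℤ) = ((m : ℤ) - n) ^ 2 := by rw [hm.2]; push_cast; rw [sq_abs]
    have h3 : |(m : ℤ) - n| ≤ c := by
      rw [h2]; simpa using Int.le_self_sq |(m : ℤ) - n|
    exact ⟨abs_le.1 h3, by rw [h2]; simp⟩
  · intro m _ m' _ hh
    simpa using hh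
  · intro y hy
    simp only [coe_filter, mem_Icc, Set.mem_ofPred_eq, Nat.cast_one, one_mul] at hy
    refine ⟨(y + n).toNat, ?_, by dsimp only; omega⟩
    simp only [coe_filter, mem_range, Set.mem_ofPred_eq]
    refine ⟨by omega, ?_⟩
    zify
    rw [sq_abs, ← hy.2, show (((y + n).toNat : ℕ) : ℤ) = y + n by omega]
    ring
  · intro m _
    exact neg_one_pow_eq_altSign

theorem mk_eq_mk_iff {M : ℕ} {a b : ℤ⟦X⟧} :
    Ideal.Quotient.mk (Ideal.span {(X : ℤ⟦X⟧) ^ (M + 1)}) a = Ideal.Quotient.mk _ b ↔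
      ∀ i ≤ M, coeff i a = coeff i b := by
  rw [Ideal.Quotient.mk_eq_mk_iff_sub_mem, Ideal.mem_span_singleton, X_pow_dvd_iff]
  simp only [map_sub, sub_eq_zero, Nat.lt_succ_iff]

theorem qFactorial_eq_of_pow_eq_zero {R : Type*} [CommRing R] {q : R} {M m : ℕ}
    (hq : q ^ (M + 1) = 0) (h : M ≤ m) : qFactorial q m = qFactorial q M := by
  induction m, h using Nat.le_induction with
  | base => rfl
  | succ m h ih =>
    rw [qFactorial, prod_range_succ, pow_eq_zero_of_le (by omega) hq, sub_zero, mul_one]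
    exact ih

theorem isUnit_qFactorial {R : Type*} [CommRing R] {q : R} (hq : IsNilpotent q) (m : ℕ) :
    IsUnit (qFactorial q m) := by
  refine prod_induction _ IsUnit (fun _ _ ↦ IsUnit.mul) isUnit_one fun i _ ↦ ?_
  exact (hq.pow_succ i).isUnit_one_sub

theorem distinctSeries_mul_theta : distinctSeries * theta 1 altSign = pentagonalSeries ℤ := by
  ext M
  revert M
  suffices h : ∀ M, Ideal.Quotient.mk (Ideal.span {(X : ℤ⟦X⟧) ^ (M + 1)})
      (distinctSeries * theta 1 altSign) = Ideal.Quotient.mk _ (pentagonalSeries ℤ) from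
    fun M ↦ mk_eq_mk_iff.1 (h M) M le_rfl
  intro M
  set π := Ideal.Quotient.mk (Ideal.span {(X : ℤ⟦X⟧) ^ (M + 1)}) with hπ
  set x := π X with hx
  have hx0 : x ^ (M + 1) = 0 := by
    rw [hx, ← map_pow, hπ, Ideal.Quotient.eq_zero_iff_mem]
    exact Ideal.mem_span_singleton_self _
  obtain ⟨n, hn, hf⟩ : ∃ n ≥ 2 * M, ∀ i ≤ M,
      coeff i (∏ j ∈ range (2 * n), (1 - (X : ℤ⟦X⟧) ^ (j + 1))) = coeff i (pentagonalSeries ℤ) := by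
    have h1 : ∀ᶠ n in Filter.atTop, ∀ i ∈ Finset.Iic M,
        coeff i (∏ j ∈ range n, (1 - (X : ℤ⟦X⟧) ^ (j + 1))) = coeff i (pentagonalSeries ℤ) := by
      rw [Filter.eventually_all_finset]
      exact fun i _ ↦ Filter.tendsto_finset_range.eventually
        (coeff_prod_one_sub_X_pow_eventually_eq ℤ i)
    obtain ⟨n₀, h1⟩ := Filter.eventually_atTop.1 h1
    exact ⟨max n₀ (2 * M), le_max_right _ _, fun i hi ↦
      h1 _ ((le_max_left n₀ (2 * M)).trans (by omega)) i (mem_Iic.2 hi)⟩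
  have hE : π distinctSeries = ∏ j ∈ range (2 * n), (1 + x ^ (j + 1)) := by
    have : π distinctSeries = π (∏ j ∈ range (2 * n), (1 + (X : ℤ⟦X⟧) ^ (j + 1))) :=
      mk_eq_mk_iff.2 fun i hi ↦ by
        rw [coeff_prod_one_add_X_pow (by omega), distinctSeries, coeff_mk]
    simpa using this
  have hp : π (pentagonalSeries ℤ) = qFactorial x (2 * n) := by
    have : π (pentagonalSeries ℤ) = π (∏ j ∈ range (2 * n), (1 - (X : ℤ⟦X⟧) ^ (j + 1))) :=
      mk_eq_mk_iff.2 fun i hi ↦ (hf i hi).symm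
    simpa [qFactorial] using this
  have hθ : ∑ m ∈ range (2 * n + 1), (-1) ^ m * x ^ (((m : ℤ) - n).natAbs ^ 2) =
      (-1) ^ n * π (theta 1 altSign) := by
    have : π (∑ m ∈ range (2 * n + 1), (-1) ^ m * (X : ℤ⟦X⟧) ^ (((m : ℤ) - n).natAbs ^ 2)) =
        π ((-1) ^ n * theta 1 altSign) :=
      mk_eq_mk_iff.2 fun i hi ↦ coeff_sum_neg_one_pow (by omega)
    simpa using this
  set G := qFactorial (x ^ 2) n
  have hq0 : (x ^ 2) ^ (M + 1) = 0 := by rw [← pow_mul, mul_comm, pow_mul, hx0, zero_pow two_ne_zero]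
  have hJ := congrArg π (sum_neg_one_pow_mul_qChoose n)
  simp only [map_sum, map_mul, map_pow, map_neg, map_one, map_qChoose, map_prod, map_sub, ← hx]
    at hJ
  have hG (m : ℕ) (hm : M ≤ m) : qFactorial (x ^ 2) m = G := by
    rw [qFactorial_eq_of_pow_eq_zero hq0 hm]
    exact (qFactorial_eq_of_pow_eq_zero hq0 (by omega)).symm
  have hGu : IsUnit G := isUnit_qFactorial ⟨_, hq0⟩ _
  set O := ∏ i ∈ range n, (1 - x ^ (2 * i + 1))
  have hterm (m : ℕ) (hm : m ∈ range (2 * n + 1)) :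
      (-1) ^ m * x ^ (((m : ℤ) - n).natAbs ^ 2) =
        ((-1) ^ m * x ^ (((m : ℤ) - n).natAbs ^ 2) * qChoose (x ^ 2) (2 * n) m) * G := by
    rw [mem_range] at hm
    by_cases hc : M + 1 ≤ ((m : ℤ) - n).natAbs ^ 2
    · rw [pow_eq_zero_of_le hc hx0]; ring
    · have h1 : ((m : ℤ) - n).natAbs ≤ M :=
        (Nat.le_self_pow two_ne_zero _).trans (by omega)
      obtain ⟨l, hl⟩ : ∃ l, 2 * n = l + m := ⟨2 * n - m, by omega⟩
      have h2 := qChoose_mul_qFactorial (x ^ 2) l m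
      rw [← hl, hG l (by omega), hG m (by omega), hG (2 * n) (by omega)] at h2
      have h3 : qChoose (x ^ 2) (2 * n) m * G = 1 := by
        apply hGu.mul_right_cancel
        rw [one_mul, mul_assoc, h2]
      rw [mul_assoc, h3, mul_one]
  have hθ2 : π (theta 1 altSign) = O ^ 2 * G := by
    rw [sum_congr rfl hterm, ← sum_mul, hJ, mul_assoc] at hθ
    exact ((isUnit_one.neg.pow n).mul_left_cancel hθ).symm
  have hOG : qFactorial x (2 * n) = O * G := by
    clear_value π
    simp only [O, G, qFactorial]
    rw [← prod_mul_distrib]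
    clear * -
    induction n with
    | zero => simp
    | succ n ih =>
      rw [prod_range_succ, ← ih, show 2 * (n + 1) = 2 * n + 1 + 1 by ring, prod_range_succ,
        prod_range_succ]
      ring
  have hpe : qFactorial x (2 * n) * ∏ j ∈ range (2 * n), (1 + x ^ (j + 1)) = G := by
    rw [← hG (2 * n) (by omega), qFactorial, qFactorial, ← prod_mul_distrib]
    exact prod_congr rfl fun j _ ↦ by ring
  rw [map_mul, hE, hθ2, hp]
  apply (isUnit_qFactorial ⟨_, hx0⟩ (2 * n)).mul_left_cancel
  rw [← mul_assoc, hpe, hOG]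
  ring

theorem chi_six_mul_sub_one (k : ℤ) : chi (6 * k - 1) = if Even k then 1 else -1 := by
  unfold chi
  grind

theorem two_mul_coeff_pentagonalSeries (i : ℕ) :
    2 * coeff i (pentagonalSeries ℤ) =
      ∑ x ∈ Icc (-(24 * i + 1 : ℤ)) (24 * i + 1) with x ^ 2 = (24 * i + 1 : ℤ), chi x := by
  by_cases h : i ∈ Set.range pentagonal
  · obtain ⟨k, rfl⟩ := h
    have hk : (24 * pentagonal k + 1 : ℤ) = (6 * k - 1) ^ 2 := by
      linear_combination 12 * two_mul_natCast_pentagonal k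
    have hs : ({x ∈ Icc (-(24 * pentagonal k + 1 : ℤ)) (24 * pentagonal k + 1) |
        x ^ 2 = (24 * pentagonal k + 1 : ℤ)} : Finset ℤ) = {6 * k - 1, -(6 * k - 1)} := by
      ext x
      rw [hk]
      simp only [mem_filter, mem_Icc, mem_insert, mem_singleton, sq_eq_sq_iff_eq_or_eq_neg,
        and_iff_right_iff_imp]
      intro hx
      have hx : |x| ≤ (6 * k - 1) ^ 2 := by
        rw [← sq_eq_sq_iff_eq_or_eq_neg] at hx
        rw [← hx]
        simpa using Int.le_self_sq |x|
      exact abs_le.1 hx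
    rw [hs, sum_pair (by omega), chi_neg, chi_six_mul_sub_one, coeff_pentagonalSeries_pentagonal]
    split_ifs with hk
    · simp [Int.negOnePow_even k hk]
    · simp [Int.negOnePow_odd k (Int.not_even_iff_odd.1 hk)]
  · rw [coeff_pentagonalSeries_eq_zero ℤ h, filter_false_of_mem, sum_empty, mul_zero]
    intro x _ hx
    have h1 (k : ℤ) (hk : x ^ 2 = (6 * k - 1) ^ 2) : False := by
      refine h ⟨k, ?_⟩
      have := two_mul_natCast_pentagonal k
      zify
      linarith
    have h2 : x % 6 = 1 ∨ x % 6 = 5 := by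
      have h6 : x ^ 2 % 6 = 1 := by omega
      have hx : x % 6 = 0 ∨ x % 6 = 1 ∨ x % 6 = 2 ∨ x % 6 = 3 ∨ x % 6 = 4 ∨ x % 6 = 5 := by omega
      rcases hx with hx | hx | hx | hx | hx | hx <;> simp [pow_two, Int.mul_emod, hx] at h6 ⊢
    rcases h2 with h2 | h2
    · apply h1 (-(x / 6))
      rw [show 6 * -(x / 6) - 1 = -x by omega, neg_sq]
    · apply h1 (x / 6 + 1)
      rw [show 6 * (x / 6 + 1) - 1 = x by omega]

/-- Twice the coefficients of `∏ (1 - q ^ n)` times a theta series are sums over representations. -/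
theorem two_mul_coeff_mul_theta {a : ℕ} (ha : 0 < a) (g : ℤ → ℤ) (n : ℕ) :
    2 * coeff n (pentagonalSeries ℤ * theta a g) =
      ∑ z ∈ reps (24 * a) (24 * n + 1), chi z.1 * g z.2 := by
  have ha' : (1 : ℤ) ≤ 24 * a := by omega
  have hz {z : ℤ × ℤ} (h : z ∈ reps (24 * a) (24 * n + 1)) :
      a * z.2 ^ 2 ≤ n ∧ z.1 ^ 2 + 24 * (a * z.2 ^ 2) = 24 * n + 1 := by
    rw [mem_reps ha'] at h
    have := sq_nonneg z.1
    exact ⟨by linarith [show (24 * n + 1 : ℤ) ≥ 24 * (a * z.2 ^ 2) by linarith], by linarith⟩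
  rw [← sum_fiberwise_of_maps_to (s := reps (24 * a) (24 * n + 1)) (t := antidiagonal n)
    (g := fun z ↦ ((n - a * z.2 ^ 2).toNat, (a * z.2 ^ 2).toNat)), coeff_mul, mul_sum]
  · refine sum_congr rfl fun p hp ↦ ?_
    rw [← mul_assoc, two_mul_coeff_pentagonalSeries, theta, coeff_mk, sum_mul_sum, ← sum_product']
    refine sum_congr ?_ fun _ _ ↦ rfl
    rw [HasAntidiagonal.mem_antidiagonal] at hp
    ext z
    have hx : |z.1| ≤ z.1 ^ 2 := by simpa using Int.le_self_sq |z.1|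
    have hy : |z.2| ≤ z.2 ^ 2 := by simpa using Int.le_self_sq |z.2|
    have hy2 : z.2 ^ 2 ≤ a * z.2 ^ 2 := by
      have := sq_nonneg z.2
      nlinarith
    rw [abs_le] at hx hy
    simp only [mem_product, mem_filter, mem_Icc]
    constructor
    · rintro ⟨⟨_, h1⟩, ⟨_, h2⟩⟩
      refine ⟨?_, ?_⟩
      · rw [mem_reps ha', ← hp]
        push_cast
        linear_combination h1 + 24 * h2
      · ext
        · simp only [h2]; omega
        · simp only [h2]; omega
    · rintro ⟨h1, h2⟩
      obtain ⟨h3, h4⟩ := hz h1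
      have h5 := congrArg Prod.fst h2
      have h6 := congrArg Prod.snd h2
      simp only at h5 h6
      have h7 : 0 ≤ a * z.2 ^ 2 := by positivity
      omega
  · intro z h
    obtain ⟨h3, h4⟩ := hz h
    have h7 : 0 ≤ a * z.2 ^ 2 := by positivity
    rw [HasAntidiagonal.mem_antidiagonal]
    omega

/-- The number of positive integers `y` with `a * y ^ 2 = u`. -/
def countSq (a u : ℕ) : ℕ := #{y ∈ Icc 1 u | a * y ^ 2 = u}

theorem countSq_one_two_mul (u : ℕ) : countSq 1 (2 * u) = countSq 2 u := by
  symm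
  refine card_nbij (fun z ↦ 2 * z) ?_ ?_ ?_
  · intro z hz
    simp only [coe_filter, mem_Icc, Set.mem_ofPred_eq] at hz ⊢
    exact ⟨by omega, by rw [← hz.2]; ring⟩
  · intro y _ z _ h
    simpa using h
  · intro y hy
    simp only [coe_filter, mem_Icc, Set.mem_ofPred_eq, one_mul] at hy
    obtain ⟨z, rfl⟩ : 2 ∣ y := Nat.prime_two.dvd_of_dvd_pow (n := 2) ⟨u, hy.2⟩
    refine ⟨z, ?_, rfl⟩
    simp only [coe_filter, mem_Icc, Set.mem_ofPred_eq]
    exact ⟨by omega, by linarith [hy.2, mul_pow 2 z 2]⟩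

theorem countSq_two_mul_two_mul {a : ℕ} (ha : 0 < a) (u : ℕ) :
    countSq (2 * a) (2 * u) = countSq a u := by
  unfold countSq
  congr 1
  ext y
  simp only [mem_filter, mem_Icc]
  refine ⟨fun h ↦ ?_, fun h ↦ ⟨by omega, by rw [mul_assoc, h.2]⟩⟩
  have h1 : a * y ^ 2 = u := by linarith [h.2]
  have h2 : y ≤ y ^ 2 := Nat.le_self_pow two_ne_zero y
  exact ⟨⟨h.1.1, by nlinarith⟩, h1⟩

theorem countSq_eq_zero_of_not_dvd {a u : ℕ} (h : ¬ a ∣ u) : countSq a u = 0 := by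
  rw [countSq, card_eq_zero, filter_eq_empty_iff]
  rintro y - rfl
  exact h (dvd_mul_right _ _)

theorem card_odd_divisors {u : ℕ} (hu : 0 < u) :
    ((#{d ∈ u.divisors | Odd d} : ℕ) : ZMod 2) = countSq 1 u + countSq 2 u := by
  induction u using Nat.strong_induction_on with
  | _ u ih =>
    rcases Nat.even_or_odd u with h | h
    · obtain ⟨w, rfl⟩ := h.two_dvd
      have hd : ({d ∈ (2 * w).divisors | Odd d} : Finset ℕ) = {d ∈ w.divisors | Odd d} := by
        ext d
        simp only [mem_filter, Nat.mem_divisors, and_congr_left_iff]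
        intro hd
        have h2 : Nat.Coprime d 2 := Nat.coprime_two_right.2 hd
        exact ⟨fun h ↦ ⟨h2.dvd_of_dvd_mul_left h.1, by omega⟩,
          fun h ↦ ⟨h.1.mul_left 2, by omega⟩⟩
      rw [hd, ih w (by omega) (by omega), countSq_one_two_mul,
        countSq_two_mul_two_mul (a := 1) one_pos, add_comm]
    · rw [countSq_eq_zero_of_not_dvd (a := 2) (by rwa [← even_iff_two_dvd, Nat.not_even_iff_odd]),
        filter_true_of_mem fun d hd ↦ h.of_dvd_nat (Nat.dvd_of_mem_divisors hd),
        ← card_filter_add_card_filter_not (fun d ↦ d * d = u)]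
      have h1 : ({d ∈ u.divisors | d * d = u} : Finset ℕ) = {y ∈ Icc 1 u | 1 * y ^ 2 = u} := by
        ext d
        simp only [mem_filter, Nat.mem_divisors, mem_Icc, one_mul, sq, and_congr_left_iff]
        intro hd
        exact ⟨fun _ ↦ ⟨by nlinarith, by nlinarith⟩, fun _ ↦ ⟨⟨d, hd.symm⟩, hu.ne'⟩⟩
      have h2 : ((#{d ∈ u.divisors | ¬ d * d = u} : ℕ) : ZMod 2) = 0 := by
        rw [card_eq_sum_ones, Nat.cast_sum]
        refine sum_involution (fun d _ ↦ u / d) (fun _ _ ↦ by decide) ?_ ?_ ?_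
        · intro d hd _ h3
          rw [mem_filter, Nat.mem_divisors] at hd
          apply hd.2
          nth_rewrite 2 [← h3]
          exact Nat.mul_div_cancel' hd.1.1
        · intro d hd
          rw [mem_filter, Nat.mem_divisors] at hd ⊢
          obtain ⟨⟨⟨e, rfl⟩, _⟩, h4⟩ := hd
          have hd0 : 0 < d := Nat.pos_of_mul_pos_right hu
          rw [Nat.mul_div_cancel_left _ hd0]
          refine ⟨⟨dvd_mul_left _ _, hu.ne'⟩, fun h5 ↦ h4 ?_⟩
          rw [Nat.eq_of_mul_eq_mul_right (Nat.pos_of_mul_pos_left hu) h5]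
        · intro d hd
          rw [mem_filter, Nat.mem_divisors] at hd
          exact Nat.div_div_self hd.1.1 hu.ne'
      rw [h1, Nat.cast_add, h2, countSq]
      simp

theorem sum_two_mul_dvd {r n : ℕ} (hr : 0 < r) (hn : r ≤ n) :
    ∑ j ∈ Icc 1 n with 2 * j ∣ r, (j : ZMod 2) = countSq 2 r + countSq 4 r := by
  rcases Nat.even_or_odd r with h | h
  · obtain ⟨u, rfl⟩ := h.two_dvd
    rw [countSq_two_mul_two_mul (a := 1) one_pos, countSq_two_mul_two_mul (a := 2) two_pos,
      ← card_odd_divisors (by omega), card_eq_sum_ones, Nat.cast_sum]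
    have hs : ({j ∈ Icc 1 n | 2 * j ∣ 2 * u} : Finset ℕ) = u.divisors := by
      ext j
      simp only [mem_filter, mem_Icc, Nat.mem_divisors, Nat.mul_dvd_mul_iff_left two_pos]
      refine ⟨fun h ↦ ⟨h.2, by omega⟩, fun h ↦ ⟨?_, h.1⟩⟩
      have := Nat.le_of_dvd (by omega) h.1
      have := Nat.pos_of_dvd_of_pos h.1 (by omega)
      omega
    rw [hs, sum_filter]
    refine sum_congr rfl fun j _ ↦ ?_
    split_ifs with hj
    · rw [Nat.cast_one]; exact (ZMod.natCast_eq_one_iff_odd).2 hj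
    · exact (ZMod.natCast_eq_zero_iff_even).2 (Nat.not_odd_iff_even.1 hj)
  · have h2 : ¬ 2 ∣ r := by rwa [← even_iff_two_dvd, Nat.not_even_iff_odd]
    rw [countSq_eq_zero_of_not_dvd h2, countSq_eq_zero_of_not_dvd fun h4 ↦
      h2 (Dvd.dvd.trans (by norm_num) h4), filter_false_of_mem fun j _ hj ↦
      h2 (dvd_of_mul_right_dvd hj)]
    simp

/-- The part of a theta series coming from positive integers. -/
noncomputable def posTheta (a : ℕ) (g : ℤ → ℤ) : ℤ⟦X⟧ :=
  PowerSeries.mk fun j ↦ ∑ y ∈ Icc 1 j with a * y ^ 2 = j, g y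

theorem theta_eq (a : ℕ) {g : ℤ → ℤ} (hg : ∀ y, g (-y) = g y) :
    theta a g = C (g 0) + 2 * posTheta a g := by
  have h1 (F : ℤ → ℤ) (hF : ∀ y, F (-y) = F y) (j : ℕ) :
      ∑ y ∈ Icc (-(j : ℤ)) j, F y = F 0 + 2 * ∑ y ∈ Icc 1 j, F y := by
    induction j with
    | zero => simp
    | succ j ih =>
      have h2 : Icc (-((j + 1 : ℕ) : ℤ)) ((j + 1 : ℕ) : ℤ) =
          insert (-((j + 1 : ℕ) : ℤ)) (insert ((j + 1 : ℕ) : ℤ) (Icc (-(j : ℤ)) j)) := by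
        ext y
        simp only [mem_Icc, mem_insert]
        omega
      rw [h2, sum_insert (by simp; omega), sum_insert (by simp), ih, sum_Icc_succ_top (by omega), hF]
      ring
  ext j
  rw [theta, coeff_mk, sum_filter, h1 _ fun y ↦ by rw [hg, neg_sq], map_add, coeff_C, posTheta,
    show (2 : ℤ⟦X⟧) = C 2 by simp, coeff_C_mul, coeff_mk, sum_filter]
  congr 1
  · simp [eq_comm]
  · norm_cast

theorem coeff_posTheta_one (a j : ℕ) : coeff j (posTheta a 1) = countSq a j := by
  simp [posTheta, countSq]

/-- Congruence modulo `2` of integral power series. -/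
theorem exists_two_mul {F G : ℤ⟦X⟧} (h : ∀ n, ((coeff n F : ℤ) : ZMod 2) = (coeff n G : ℤ)) :
    ∃ K, F = G + 2 * K := by
  have h1 (n : ℕ) : ∃ k, coeff n F = coeff n G + 2 * k := by
    obtain ⟨k, hk⟩ := (ZMod.intCast_eq_intCast_iff_dvd_sub _ _ 2).1 (h n).symm
    exact ⟨k, by push_cast at hk; linarith⟩
  choose k hk using h1
  refine ⟨PowerSeries.mk k, ?_⟩
  ext n
  rw [hk, map_add, show (2 : ℤ⟦X⟧) = C 2 by simp, coeff_C_mul, coeff_mk]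

theorem exists_sq_eq_expand (F : ℤ⟦X⟧) : ∃ K, F ^ 2 = F.expand 2 two_ne_zero + 2 * K := by
  refine exists_two_mul fun n ↦ ?_
  set ρ := Int.castRingHom (ZMod 2)
  have h : (PowerSeries.map ρ F) ^ 2 = (PowerSeries.map ρ F).expand 2 two_ne_zero := by
    have := MvPowerSeries.map_frobenius_expand (R := ZMod 2) (σ := Unit) 2 two_ne_zero
      (f := PowerSeries.map ρ F)
    rw [ZMod.frobenius_zmod] at this
    exact this.symm
  have h2 := congrArg (coeff n) h
  rw [← map_pow, coeff_map, coeff_expand] at h2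
  rw [coeff_expand]
  split_ifs at h2 ⊢ <;> simpa [ρ] using h2

theorem expand_posTheta_one : (posTheta 1 1).expand 2 two_ne_zero = posTheta 2 1 := by
  ext n
  rw [coeff_expand, coeff_posTheta_one]
  split_ifs with h
  · obtain ⟨u, rfl⟩ := h
    rw [Nat.mul_div_cancel_left _ two_pos, coeff_posTheta_one,
      countSq_two_mul_two_mul (a := 1) one_pos]
  · rw [coeff_posTheta_one, countSq_eq_zero_of_not_dvd h, Nat.cast_zero]

theorem exists_posTheta_sq :
    ∃ K, posTheta 1 altSign ^ 2 = posTheta 2 1 + 2 * K := by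
  obtain ⟨K, hK⟩ := exists_sq_eq_expand (posTheta 1 1)
  obtain ⟨L, hL⟩ : ∃ L, posTheta 1 altSign = posTheta 1 1 + 2 * L := by
    refine exists_two_mul fun n ↦ ?_
    simp only [posTheta, coeff_mk]
    rw [Int.cast_sum, Int.cast_sum]
    refine sum_congr rfl fun y _ ↦ ?_
    unfold altSign
    split_ifs <;> simp
  rw [expand_posTheta_one] at hK
  exact ⟨K + 2 * posTheta 1 1 * L + 2 * L ^ 2, by rw [hL]; linear_combination hK⟩

theorem theta_one (a : ℕ) : theta a 1 = 1 + 2 * posTheta a 1 := by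
  simpa using theta_eq a (g := 1) fun _ ↦ rfl

theorem theta_altSign (a : ℕ) : theta a altSign = 1 + 2 * posTheta a altSign := by
  simpa [altSign] using theta_eq a altSign_neg

/-- The distinct partition function modulo `8`. -/
theorem exists_distinctSeries_eq : ∃ K,
    distinctSeries = pentagonalSeries ℤ * (2 * theta 2 1 - theta 1 altSign) + 8 * K := by
  obtain ⟨K, hK⟩ := exists_posTheta_sq
  have h := distinctSeries_mul_theta
  rw [theta_altSign] at h
  rw [theta_altSign, theta_one]
  refine ⟨pentagonalSeries ℤ * K - distinctSeries * posTheta 1 altSign ^ 3, ?_⟩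
  linear_combination (1 - 2 * posTheta 1 altSign + 4 * posTheta 1 altSign ^ 2) * h +
    4 * pentagonalSeries ℤ * hK

theorem two_mul_theta_four : 2 * theta 4 1 = theta 1 1 + theta 1 altSign := by
  ext n
  rw [show (2 : ℤ⟦X⟧) = C 2 by simp, coeff_C_mul, map_add, theta, theta, theta, coeff_mk, coeff_mk,
    coeff_mk, ← sum_add_distrib, mul_sum]
  have h1 (y : ℤ) : (1 : ℤ → ℤ) y + altSign y = if Even y then 2 else 0 := by
    unfold altSign
    split_ifs <;> simp
  simp only [h1]
  rw [← sum_filter, filter_filter]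
  refine sum_nbij (fun y ↦ 2 * y) ?_ ?_ ?_ ?_
  · intro y hy
    simp only [mem_filter, mem_Icc] at hy ⊢
    have h2 : |2 * y| ≤ n := by
      have h3 : |2 * y| ≤ (2 * y) ^ 2 := by
        simpa only [sq_abs] using Int.le_self_sq |2 * y|
      have := hy.2
      push_cast at this
      linarith
    refine ⟨abs_le.1 h2, ?_, even_two_mul y⟩
    rw [← hy.2]
    push_cast
    ring
  · intro y _ z _ h
    simpa using h
  · intro y hy
    simp only [coe_filter, mem_Icc, Set.mem_ofPred_eq] at hy
    obtain ⟨z, rfl⟩ := hy.2.2.two_dvd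
    refine ⟨z, ?_, rfl⟩
    simp only [coe_filter, mem_Icc, Set.mem_ofPred_eq]
    refine ⟨by omega, ?_⟩
    rw [← hy.2.1]
    push_cast
    ring
  · intro y _
    simp

theorem sum_mul_countContaining_modTwo (n : ℕ) :
    ((∑ j ∈ Icc 1 n, j * countContaining (2 * j) n : ℕ) : ZMod 2) =
      ((coeff n (distinctSeries * (posTheta 2 1 + posTheta 4 1)) : ℤ) : ZMod 2) := by
  have h1 : ((∑ j ∈ Icc 1 n, j * countContaining (2 * j) n : ℕ) : ZMod 2) =
      ∑ t ∈ range n, (#(distinctSets t) : ZMod 2) * (countSq 2 (n - t) + countSq 4 (n - t)) := by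
    have h2 (t : ℕ) (ht : t ∈ range n) :
        (#(distinctSets t) : ZMod 2) * (countSq 2 (n - t) + countSq 4 (n - t)) =
        ∑ j ∈ Icc 1 n, if 2 * j ∣ n - t then (#(distinctSets t) : ZMod 2) * j else 0 := by
      rw [mem_range] at ht
      rw [← sum_two_mul_dvd (n := n) (by omega) (by omega), mul_sum, sum_filter]
    rw [sum_congr rfl h2, sum_comm, Nat.cast_sum]
    refine sum_congr rfl fun j hj ↦ ?_
    rw [mem_Icc] at hj
    rw [Nat.cast_mul, countContaining_modTwo (by omega), mul_sum, sum_filter]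
    exact sum_congr rfl fun t _ ↦ by simp only [mul_comm]
  rw [h1, coeff_mul, Int.cast_sum, Nat.sum_antidiagonal_eq_sum_range_succ_mk, sum_range_succ]
  simp only [map_add, coeff_posTheta_one, distinctSeries, coeff_mk]
  simp [countSq]

/-- `DSOME` modulo `8`. -/
theorem exists_DSOME_eq (n : ℕ) : ∃ k, DSOME n = n * #(distinctSets n) - coeff n
    (pentagonalSeries ℤ * (2 * theta 2 1 + theta 1 1 + theta 1 altSign - 4)) + 8 * k := by
  obtain ⟨k, hk⟩ := (ZMod.intCast_eq_intCast_iff_dvd_sub _ _ 2).1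
    ((sum_mul_countContaining_modTwo n).symm.trans (Int.cast_natCast _).symm).symm
  have h := distinctSeries_mul_theta
  rw [theta_altSign] at h
  have h2 : pentagonalSeries ℤ * (2 * theta 2 1 + theta 1 1 + theta 1 altSign - 4) =
      C 4 * (distinctSeries * (posTheta 2 1 + posTheta 4 1)) +
      C 8 * (distinctSeries * posTheta 1 altSign * (posTheta 2 1 + posTheta 4 1)) := by
    rw [add_assoc (2 * theta 2 1), ← two_mul_theta_four, theta_one, theta_one, ← h]
    simp only [map_ofNat]
    ring
  rw [DSOME_eq, h2, map_add, coeff_C_mul, coeff_C_mul]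
  refine ⟨coeff n (distinctSeries * posTheta 1 altSign * (posTheta 2 1 + posTheta 4 1)) +
    k, ?_⟩
  push_cast at hk ⊢
  linarith

theorem coeff_six_hundred_twenty_five_theta_two (n : ℕ) (g : ℤ → ℤ) (hg : ∀ y, g (5 * y) = g y) :
    coeff (625 * n + 26) (pentagonalSeries ℤ * theta 2 g) =
      coeff n (pentagonalSeries ℤ * theta 2 g) := by
  have h5 (x y : ℤ) : chi (5 * x) * g (5 * y) = -(chi x * g y) := by
    rw [chi_five_mul, hg, neg_mul]
  have h1 := sum_reps_forty_eight (24 * n + 1) (fun z ↦ chi z.1 * g z.2) h5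
  have h2 := sum_reps_forty_eight (25 * (24 * n + 1)) (fun z ↦ chi z.1 * g z.2) h5
  have h3 := two_mul_coeff_mul_theta two_pos g n
  have h4 := two_mul_coeff_mul_theta two_pos g (625 * n + 26)
  rw [show (24 * (625 * n + 26 : ℕ) + 1 : ℤ) = 25 * (25 * (24 * n + 1)) by push_cast; ring] at h4
  norm_num at h3 h4
  linarith

theorem coeff_six_hundred_twenty_five_theta_one (n : ℕ) :
    coeff (625 * n + 26) (pentagonalSeries ℤ * theta 1 1) =
      coeff n (pentagonalSeries ℤ * theta 1 1) := by
  have h1 := sum_reps_mul_625 (24 * n + 1) 1 (one_pow 2) (fun z ↦ chi z.1) (fun _ _ ↦ rfl)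
    (fun x _ ↦ chi_five_mul x) (fun x y ↦ by rw [one_mul]; exact chi_sub_mul x y)
  have h3 := two_mul_coeff_mul_theta one_pos 1 n
  have h4 := two_mul_coeff_mul_theta one_pos 1 (625 * n + 26)
  rw [show (24 * (625 * n + 26 : ℕ) + 1 : ℤ) = 625 * (24 * n + 1) by push_cast; ring] at h4
  norm_num at h1 h3 h4
  linarith

theorem coeff_six_hundred_twenty_five_theta_altSign (n : ℕ) : ∃ k,
    coeff (625 * n + 26) (pentagonalSeries ℤ * theta 1 altSign) =
      5 * coeff n (pentagonalSeries ℤ * theta 1 altSign) + 8 * k := by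
  set g : ℤ × ℤ → ℤ := fun z ↦ chi z.1 * altSign z.2
  have hc (x y : ℤ) : g (x, -y) = g (x, y) := by simp only [g, altSign_neg]
  have hn (x y : ℤ) : g (-x, y) = g (x, y) := by simp only [g, chi_neg]
  have h5 (x y : ℤ) : g (5 * x, 5 * y) = -g (x, y) := by
    have : altSign (5 * y) = altSign y := by unfold altSign; grind
    simp only [g, chi_five_mul, this, neg_mul]
  have hω (x y : ℤ) : g (x - 24 * y, x + y) = -g (x, y) := by
    simp only [g, chi_sub_mul]
    rcases Int.even_or_odd x with hx | hx
    · rw [chi_of_even hx, zero_mul, zero_mul, neg_zero]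
    · have : altSign (x + y) = -altSign y := by unfold altSign; grind
      rw [this, mul_neg]
  obtain ⟨k, hk⟩ := four_dvd_sum_reps_ideal (24 * n + 1) ⟨12 * n, by ring⟩ g hc hn h5 hω
  have h1 := sum_reps_mul_625 (24 * n + 1) (-1) (by norm_num) g hc h5
    (fun x y ↦ by rw [hω, neg_one_mul])
  have h2 := sum_filter_add_sum_filter_not (reps 24 (24 * n + 1)) (fun z ↦ 5 ∣ z.1 + z.2) g
  have h3 := two_mul_coeff_mul_theta one_pos altSign n
  have h4 := two_mul_coeff_mul_theta one_pos altSign (625 * n + 26)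
  rw [show (24 * (625 * n + 26 : ℕ) + 1 : ℤ) = 625 * (24 * n + 1) by push_cast; ring] at h4
  rw [Nat.cast_one, mul_one] at h3 h4
  exact ⟨-k, by linarith⟩

theorem coeff_six_hundred_twenty_five_pentagonalSeries (n : ℕ) :
    coeff (625 * n + 26) (pentagonalSeries ℤ) = coeff n (pentagonalSeries ℤ) := by
  have h : theta 2 (fun y ↦ if y = 0 then 1 else 0) = 1 := by
    ext j
    rw [theta, coeff_mk, coeff_one, sum_ite_eq']
    simp [eq_comm]
  simpa [h] using coeff_six_hundred_twenty_five_theta_two n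
    (fun y ↦ if y = 0 then 1 else 0) fun y ↦ by simp

theorem exists_coeff_mul_theta_one (n : ℕ) : ∃ k,
    coeff n (pentagonalSeries ℤ * theta 1 1) = coeff n (pentagonalSeries ℤ) + 2 * k := by
  refine ⟨coeff n (pentagonalSeries ℤ * posTheta 1 1), ?_⟩
  rw [theta_one, mul_add, mul_one, map_add, ← coeff_C_mul]
  simp [mul_left_comm]

theorem exists_coeff_mul_theta_altSign (n : ℕ) : ∃ k,
    coeff n (pentagonalSeries ℤ * theta 1 altSign) = coeff n (pentagonalSeries ℤ) + 2 * k := by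
  refine ⟨coeff n (pentagonalSeries ℤ * posTheta 1 altSign), ?_⟩
  rw [theta_altSign, mul_add, mul_one, map_add, ← coeff_C_mul]
  simp [mul_left_comm]

theorem exists_card_distinctSets_eq (n : ℕ) : ∃ k, (#(distinctSets n) : ℤ) =
    2 * coeff n (pentagonalSeries ℤ * theta 2 1) -
      coeff n (pentagonalSeries ℤ * theta 1 altSign) + 8 * k := by
  obtain ⟨K, hK⟩ := exists_distinctSeries_eq
  have h : distinctSeries = C 2 * (pentagonalSeries ℤ * theta 2 1) -
      pentagonalSeries ℤ * theta 1 altSign + C 8 * K := by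
    rw [hK]
    simp only [map_ofNat]
    ring
  refine ⟨coeff n K, ?_⟩
  simpa only [map_add, map_sub, coeff_C_mul, distinctSeries, coeff_mk] using congrArg (coeff n) h

theorem coeff_theta_combination (n : ℕ) : coeff n
    (pentagonalSeries ℤ * (2 * theta 2 1 + theta 1 1 + theta 1 altSign - 4)) =
      2 * coeff n (pentagonalSeries ℤ * theta 2 1) + coeff n (pentagonalSeries ℤ * theta 1 1) +
      coeff n (pentagonalSeries ℤ * theta 1 altSign) - 4 * coeff n (pentagonalSeries ℤ) := by
  rw [← coeff_C_mul, ← coeff_C_mul, ← map_add, ← map_add, ← map_sub]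
  congr 1
  simp only [map_ofNat]
  ring

/-- `DSOME(625n + 26) ≡ 5 DSOME(n) - 2 d(n) (mod 8)`, where `d(n)` is the number
of partitions of `n` into distinct parts. -/
theorem DSOME_625_congruence (n : ℕ) :
    DSOME (625 * n + 26) ≡
      5 * DSOME n - 2 * ((Nat.Partition.distincts n).card : ℤ) [ZMOD 8] := by
  rw [card_distincts]
  obtain ⟨k₁, h₁⟩ := exists_DSOME_eq n
  obtain ⟨k₂, h₂⟩ := exists_DSOME_eq (625 * n + 26)
  obtain ⟨k₃, h₃⟩ := exists_card_distinctSets_eq n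
  obtain ⟨k₄, h₄⟩ := exists_card_distinctSets_eq (625 * n + 26)
  obtain ⟨k₅, h₅⟩ := coeff_six_hundred_twenty_five_theta_altSign n
  obtain ⟨k₆, h₆⟩ := exists_coeff_mul_theta_one n
  obtain ⟨k₇, h₇⟩ := exists_coeff_mul_theta_altSign n
  rw [coeff_theta_combination] at h₁ h₂
  rw [coeff_six_hundred_twenty_five_theta_two n 1 fun _ ↦ rfl] at h₂ h₄
  rw [coeff_six_hundred_twenty_five_theta_one, coeff_six_hundred_twenty_five_pentagonalSeries] at h₂
  rw [h₅] at h₂ h₄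
  obtain ⟨e, he⟩ : ∃ e, (#(distinctSets (625 * n + 26)) : ℤ) = 5 * #(distinctSets n) + 8 * e :=
    ⟨-coeff n (pentagonalSeries ℤ * theta 2 1) + k₄ - k₅ - 5 * k₃, by linarith⟩
  rw [he] at h₂
  rw [h₁, h₂, Int.modEq_iff_dvd]
  push_cast
  rw [show (625 * (n : ℤ) + 26) * (5 * (#(distinctSets n) : ℤ) + 8 * e) =
    5 * (n * #(distinctSets n)) + 130 * #(distinctSets n) +
      8 * ((625 * n + 26) * e + 390 * (n * #(distinctSets n))) by ring]
  omega
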